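/- Let T be the Bolyai–Rényi map and let μ be any T-invariant Borel probability measure on [0,1) that is absolutely continuous with respect to Lebesgue measure. Then the Lochs-type constant log(3) / ∫ log(2x+2) dμ(x) satisfies |log(3)/∫ log(2x+2) dμ(x) − 1.0400442024560391758760644376817446547515185552379| ≤ 10⁻⁴⁹. -/

import Mathlib

open MeasureTheory Real Filter

/-- The Bolyai–Rényi map. -/
noncomputable def T (x : ℝ) : ℝ :=
  if x < Real.sqrt 2 - 1 then x ^ 2 + 2 * x
  else if x < Real.sqrt 3 - 1 then x ^ 2 + 2 * x - 1
  else x ^ 2 + 2 * x - 2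


namespace BR

/-! ### Integer polynomials as coefficient lists -/

/-- Evaluation of a coefficient list (constant term first). -/
noncomputable def ev : List ℤ → ℝ → ℝ
  | [], _ => 0
  | a :: l, t => a + t * ev l t

/-- Sum of two polynomials. -/
noncomputable def padd (l : List ℤ) : List ℤ → List ℤ :=
  List.rec (fun m => m)
    (fun a l ih m => List.rec (a :: l) (fun b mt _ => Int.add a b :: ih mt) m) l

/-- Scalar multiple. -/
noncomputable def psmul (c : ℤ) (l : List ℤ) : List ℤ :=
  List.rec [] (fun a _ ih => Int.mul c a :: ih) l

/-- Product. -/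
noncomputable def pmul (l m : List ℤ) : List ℤ :=
  List.rec [] (fun a _ ih => padd (psmul a m) (0 :: ih)) l

/-- Derivative. -/
noncomputable def pder : List ℤ → List ℤ
  | [] => []
  | _ :: l => padd l (0 :: pder l)

/-- Composition with the linear polynomial `c + d t`. -/
noncomputable def pcomp (c d : ℤ) : List ℤ → List ℤ
  | [] => []
  | a :: l => padd [a] (padd (psmul c (pcomp c d l)) (0 :: psmul d (pcomp c d l)))

/-- Even part. -/
noncomputable def peven : List ℤ → List ℤ
  | [] => []
  | [a] => [a]
  | a :: _ :: l => a :: peven l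

/-- Odd part. -/
noncomputable def podd : List ℤ → List ℤ
  | [] => []
  | [_] => []
  | _ :: b :: l => b :: podd l

/-- The `l1` norm of the coefficients. -/
noncomputable def l1 : List ℤ → ℕ
  | [] => 0
  | a :: l => a.natAbs + l1 l

/-- Taylor coefficients (in absolute value) of `w ^ (-3/2)`. -/
noncomputable def vmag (w0 : ℕ) : ℕ → ℕ → ℕ → List ℕ
  | 0, _, _ => []
  | f + 1, n, b => b :: vmag w0 f (n + 1) (b * (3 + 2 * n) / ((n + 1) * w0))

/-- Alternating signs. -/
noncomputable def altSign : Bool → List ℕ → List ℤ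
  | _, [] => []
  | s, b :: l => (if s then (b : ℤ) else -(b : ℤ)) :: altSign (!s) l

/-- The certificate polynomial. -/
noncomputable def Q : List ℤ :=
  [0, 1810038937124558019072565967964897815972718632915389190157772073831,
  -163554697067671261395619353219734472582928190175722739645357875106, 27315117855227232548978224962704452016630235657337925725789559029,
  -5735693772873547177025272471416702812452864234219583779171007561, 1351183016182710280566542960035923164801327770048006881012193622,
  -340639734493919821528922506777222130545553201075235502698327601, 89779682239486533846304968500678854368509657544468065213286007,
  -24416470193127021887203556270938525079428991486217909497135017, 6797247196320866179911457679702653967930226788997044803026914,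
  -1926854007364211122158084853113903007894257078033453113256361, 554182337279754207545195242457216412759112152578818993448307,
  -161289371249050941681740298627504953121729049451727848729877, 47408592695171730890157797671715069055100488233022523014734,
  -14052475086068252334206475918180146170488602036083027103014, 4195454092803392528302778476314747824732120535686284896070,
  -1260443659049391836694531505515756904703449965941276488541, 380759223326518057445647226270699641265489914244912921574,
  -115579938696789467911735237607365289405954865615358495319, 35236062926000752407473749154598987767316608630527954888,
  -10783727196703832198745254260808086147558973193492422960, 3311764552462330565474938334586660471008515461034377181,
  -1020269307406688696172756972472281541699179804189384085, 315217185639627524338283346836747856770522638479409502,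
  -97641710128032671771499497750511834360559355536607885, 30317630384418393748534602852140618476885192881319596,
  -9434190100022152992156439451047610301740594876590543, 2941629965000437274979851012930747680279167559797422,
  -918920904282452181821078970800156335375692267037290, 287550711587517235052358316764576751807917369703289,
  -90124428029253485229820332287912246705871659311192, 28288705992155023777454059709281381187120562048026,
  -8891629967556046821561747840664044921252125581814, 2798379652305216564465715194449369331557717041216,
  -881762332843689678451136390977715076058941427596, 278151803835757351866385139741284512649726179309,
  -87834704509206666293542304806825943394486401688, 27763566024342390289061015076188183901591850876,
  -8783796263850640126422335812982077238267925732, 2781391681643465005342619575233822134362950381,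
  -881437749742203489004792304249448837425149486, 279543235310056201578014791444092482197572826,
  -88718421975602716952980380700863140946359140, 28175198945928979840554757681285179868595721,
  -8953452632652305378608649728084420099375813, 2846868936883477695210936860374055855537097,
  -905694486920097160806569105990011887173960, 288282347878362552772493606861657537144850,
  -91804074644020320219661759441133297182534, 29248232283043518810404069513744928656014,
  -9322187485570446355410209592927522732397, 2972377189495383349049731212154784386044,
  -948081576597879865007176754030479750104, 302504235898595687019270971761149471556,
  -96549457283452803100753366044460002594, 30824060198300510207008481530227675805,
  -9843301719225091942919120703328417698, 3144070538462691888599230718776672097,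
  -1004463388599732146577451443660855573, 320963985466222369669058382798433771,
  -102576773714256300429271870103447267, 32787070492669696647025061595364572,
  -10481114112305229790323465577786169, 3350842508788322888850798221986551,
  -1071353588180131053359906772295565, 342558229874511036372328634807504,
  -109534074578585293771919382104673, 35024164209093985763812235781676,
  -11199028964533743388255179010164, 3580776671996215093201691563482,
  -1144849654081795519330755666233, 366002384825667957492918755113,
  -116996605570921707144218799487, 37394340557645557108473227041,
  -11950080632786185679008141534, 3818183892529280174569743294,
  -1219697671689541132242329694, 389533426770203723660904514,
  -124371754803831359198757248, 39698126162628368367769885,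
  -12667051239233818327812879, 4040393255470205925442932,
  -1288246058099670215964285, 410567561250531802887273,
  -130786698072216062763007, 41640600314099650361411,
  -13250274229777028145382, 4213720841692065310194,
  -1339110827071055030148, 425257634080654365278,
  -134941452127292116499, 42782553079539186730,
  -13551385329880034203, 4288059627016992684,
  -1355373099464444673, 427892255163293809,
  -134908472072024564, 42473620949461738,
  -13351005823592219, 4189428969997846,
  -1312091157014982, 410064844338942,
  -127855077199603, 39759553941345,
  -12327759070806, 3809621790718,
  -1172840960068, 359517571145,
  -109657118835, 33253109353,
  -10015125021, 2991786021,
  -884897748, 258531167,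
  -74360908, 20954251,
  -5741360, 1510350,
  -372528, 81684,
  -13434]

/-- Derivative of the certificate polynomial. -/
noncomputable def Q1 : List ℤ := pder Q
/-- The (unnormalised) distribution function. -/
noncomputable def Hp : List ℤ := pmul [3, 1] Q1
/-- The approximate (unnormalised) invariant density. -/
noncomputable def hp : List ℤ := psmul 2 (pder Hp)
/-- `hp (s - 3)`. -/
noncomputable def gp : List ℤ := pcomp (-3) 1 hp
/-- Even part of `gp`. -/
noncomputable def Ap : List ℤ := peven gp
/-- Odd part of `gp`. -/
noncomputable def Bp : List ℤ := podd gp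
/-- The polynomial multiplying `w ^ (-3/2)` in the derivative. -/
noncomputable def Kp : List ℤ := padd (psmul 4 (0 :: pder Ap)) (psmul (-2) Ap)
/-- `Kp` on the branch with `w = c + 2 t`. -/
noncomputable def Gp (c : ℤ) : List ℤ := pcomp c 2 Kp
/-- Derivative of `Bp` on the branch with `w = c + 2 t`. -/
noncomputable def Bq (c : ℤ) : List ℤ := pcomp c 2 (pder Bp)
/-- Approximation of `2 ^ 360 w ^ (-3/2)` on the first branch. -/
noncomputable def V0 : List ℤ := altSign true (vmag 6 191 0 159798082416500486423504982041142310671639310670588176916466526758885303241975677780868248120481223705868936)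
/-- Approximation of `2 ^ 360 w ^ (-3/2)` on the second branch. -/
noncomputable def V1 : List ℤ := altSign true (vmag 10 141 0 74267437434598396803790076282061150189731116524318401835519481751929931988485695957758759894847192714639722)
/-- Approximation of `2 ^ 360 w ^ (-3/2)` on the third branch. -/
noncomputable def V2 : List ℤ := altSign true (vmag 14 131 0 44833886239739100843261799246520284279666124765281815370764478280510378547794124496580954601580323804123870)
/-- The residual in the equation `v ^ 2 w ^ 3 = 1`. -/
noncomputable def Vres (V : List ℤ) (c : ℤ) : List ℤ :=
  padd [-2 ^ 720] (pmul [c, 2] (pmul [c, 2] (pmul [c, 2] (pmul V V))))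
/-- The main residual. -/
noncomputable def Eres : List ℤ :=
  padd (padd (pmul (Gp 6) V0) (padd (pmul (Gp 10) V1) (pmul (Gp 14) V2)))
    (psmul (2 ^ 360) (padd (psmul 4 (padd (Bq 6) (padd (Bq 10) (Bq 14)))) (psmul (-2) (pder hp))))
/-- The leading coefficient dominates. -/
noncomputable def dom : List ℤ → Bool
  | [] => false
  | a :: l => decide ((l1 l : ℤ) ≤ a)

set_option maxRecDepth 100000

theorem dom_V0 : dom V0 = true := by decide +kernel
theorem dom_V1 : dom V1 = true := by decide +kernel
theorem dom_V2 : dom V2 = true := by decide +kernel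
theorem Eres_le : l1 Eres * 10 ^ 54 ≤ 2 ^ 580 := by decide +kernel
theorem Vres0_le : l1 (Gp 6) * l1 (Vres V0 6) * 10 ^ 53 ≤ 2 ^ 940 := by decide +kernel
theorem Vres1_le : l1 (Gp 10) * l1 (Vres V1 10) * 10 ^ 53 ≤ 2 ^ 940 := by decide +kernel
theorem Vres2_le : l1 (Gp 14) * l1 (Vres V2 14) * 10 ^ 53 ≤ 2 ^ 940 := by decide +kernel

theorem padd_nil (m : List ℤ) : padd [] m = m := rfl
theorem padd_cons_nil (a : ℤ) (l : List ℤ) : padd (a :: l) [] = a :: l := rfl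
theorem padd_cons_cons (a b : ℤ) (l m : List ℤ) :
    padd (a :: l) (b :: m) = (a + b) :: padd l m := rfl
theorem psmul_nil (c : ℤ) : psmul c [] = [] := rfl
theorem psmul_cons (c a : ℤ) (l : List ℤ) : psmul c (a :: l) = (c * a) :: psmul c l := rfl
theorem pmul_nil (m : List ℤ) : pmul [] m = [] := rfl
theorem pmul_cons (a : ℤ) (l m : List ℤ) :
    pmul (a :: l) m = padd (psmul a m) (0 :: pmul l m) := rfl

theorem ev_nil (t : ℝ) : ev [] t = 0 := rfl
theorem ev_cons (a : ℤ) (l : List ℤ) (t : ℝ) : ev (a :: l) t = a + t * ev l t := rfl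

theorem ev_padd (l m : List ℤ) (t : ℝ) : ev (padd l m) t = ev l t + ev m t := by
  induction l generalizing m with
  | nil => simp [padd_nil, ev_nil]
  | cons a l ih =>
    cases m with
    | nil => simp [padd_cons_nil, ev_nil]
    | cons b m =>
      rw [padd_cons_cons, ev_cons, ev_cons, ev_cons, ih]
      push_cast
      ring

theorem ev_psmul (c : ℤ) (l : List ℤ) (t : ℝ) : ev (psmul c l) t = c * ev l t := by
  induction l with
  | nil => simp [psmul_nil, ev_nil]
  | cons a l ih =>
    rw [psmul_cons, ev_cons, ev_cons, ih]
    push_cast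
    ring

theorem ev_pmul (l m : List ℤ) (t : ℝ) : ev (pmul l m) t = ev l t * ev m t := by
  induction l with
  | nil => simp [pmul_nil, ev_nil]
  | cons a l ih =>
    rw [pmul_cons, ev_padd, ev_psmul, ev_cons, ev_cons, ih]
    push_cast
    ring

theorem ev_pcomp (c d : ℤ) (l : List ℤ) (t : ℝ) : ev (pcomp c d l) t = ev l (c + d * t) := by
  induction l with
  | nil => simp [pcomp, ev_nil]
  | cons a l ih =>
    rw [pcomp, ev_padd, ev_padd, ev_psmul, ev_cons, ev_cons, ev_cons, ev_psmul, ih, ev_nil]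
    push_cast
    ring

theorem hasDerivAt_ev (l : List ℤ) (t : ℝ) : HasDerivAt (ev l) (ev (pder l) t) t := by
  induction l with
  | nil => simpa [pder, ev] using hasDerivAt_const t (0 : ℝ)
  | cons a l ih =>
    have h := ((hasDerivAt_id t).mul ih).const_add (a : ℝ)
    rw [pder, ev_padd, ev_cons]
    refine h.congr_deriv ?_
    simp

theorem ev_split : ∀ (l : List ℤ) (s : ℝ),
    ev l s = ev (peven l) (s ^ 2) + s * ev (podd l) (s ^ 2)
  | [], s => by simp [peven, podd, ev]
  | [a], s => by simp [peven, podd, ev]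
  | a :: b :: l, s => by
    rw [peven, podd, ev_cons, ev_cons, ev_cons, ev_cons, ev_split l s]
    ring

theorem abs_ev_le (l : List ℤ) (t : ℝ) (ht : |t| ≤ 1) : |ev l t| ≤ l1 l := by
  induction l with
  | nil => simp [ev, l1]
  | cons a l ih =>
    rw [ev_cons, l1]
    push_cast
    refine (abs_add_le _ _).trans ?_
    rw [abs_mul]
    have h1 : |t| * |ev l t| ≤ 1 * l1 l := by gcongr
    have h2 : |(a : ℝ)| = ((a.natAbs : ℕ) : ℝ) := by
      rw [Nat.cast_natAbs]; simp
    linarith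

theorem continuous_ev (l : List ℤ) : Continuous (ev l) :=
  continuous_iff_continuousAt.2 fun t => (hasDerivAt_ev l t).continuousAt

theorem ev_nonneg_of_dom (l : List ℤ) (h : dom l = true) (t : ℝ) (ht : |t| ≤ 1) :
    0 ≤ ev l t := by
  cases l with
  | nil => simp [ev]
  | cons a l =>
    simp only [dom, decide_eq_true_eq] at h
    have h1 := abs_ev_le l t ht
    have h2 : ((l1 l : ℕ) : ℝ) ≤ a := by exact_mod_cast h
    have h3 : |t * ev l t| ≤ 1 * l1 l := by rw [abs_mul]; gcongr
    rw [ev_cons]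
    have := (abs_le.1 h3).1
    linarith

/-- Error of the approximation of `S ^ (-3)`. -/
theorem v_err (V : List ℤ) (c : ℤ) (hdom : dom V = true) (t S : ℝ) (ht : |t| ≤ 1) (hS : 1 ≤ S)
    (hS2 : S ^ 2 = c + 2 * t) :
    |ev V t - 2 ^ 360 * (S ^ 3)⁻¹| * 2 ^ 360 ≤ (l1 (Vres V c) : ℝ) := by
  have h0 := ev_nonneg_of_dom V hdom t ht
  have h1 := abs_ev_le (Vres V c) t ht
  have h2 : ev (Vres V c) t = (ev V t - 2 ^ 360 * (S ^ 3)⁻¹) *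
      ((ev V t + 2 ^ 360 * (S ^ 3)⁻¹) * S ^ 6) := by
    have : S ^ 6 = (c + 2 * t) ^ 3 := by rw [← hS2]; ring
    have e1 : (ev V t - 2 ^ 360 * (S ^ 3)⁻¹) *
      ((ev V t + 2 ^ 360 * (S ^ 3)⁻¹) * S ^ 6) = ev V t ^ 2 * S ^ 6 - (2 ^ 360) ^ 2 := by
      field_simp
      ring
    rw [e1, this]
    simp only [Vres, ev_padd, ev_pmul, ev_cons, ev_nil]
    push_cast
    ring
  rw [h2, abs_mul] at h1
  refine le_trans ?_ h1
  gcongr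
  have h3 : (2 : ℝ) ^ 360 ≤ (ev V t + 2 ^ 360 * (S ^ 3)⁻¹) * S ^ 6 := by
    have e2 : (ev V t + 2 ^ 360 * (S ^ 3)⁻¹) * S ^ 6 = ev V t * S ^ 6 + 2 ^ 360 * S ^ 3 := by
      field_simp
    rw [e2]
    have this1 : (1 : ℝ) ≤ S ^ 3 := one_le_pow₀ hS
    have this2 : 0 ≤ ev V t * S ^ 6 := by positivity
    have h7 := mul_le_mul_of_nonneg_left this1 (pow_pos (two_pos : (0 : ℝ) < 2) 360).le
    rw [mul_one] at h7
    linarith only [h7, this2]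
  exact h3.trans (le_abs_self _)

theorem G_err_aux (z y g v l m : ℝ) (hz : 0 < z) (hg : |g| ≤ l) (hv : |v| * z ≤ m)
    (h : l * m * 10 ^ 53 ≤ z * y) : |g * v| * 10 ^ 53 ≤ y := by
  refine le_of_mul_le_mul_left ?_ hz
  calc z * (|g * v| * 10 ^ 53) = |g| * (|v| * z) * 10 ^ 53 := by rw [abs_mul]; ring
    _ ≤ l * m * 10 ^ 53 := by gcongr; exact (abs_nonneg _).trans hg
    _ ≤ z * y := h

theorem G_err (V : List ℤ) (c : ℤ) (hdom : dom V = true)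
    (hle : l1 (Gp c) * l1 (Vres V c) * 10 ^ 53 ≤ 2 ^ 940)
    (t S : ℝ) (ht : |t| ≤ 1) (hS : 1 ≤ S) (hS2 : S ^ 2 = c + 2 * t) :
    |ev (Gp c) t * ev V t - 2 ^ 360 * (ev (Gp c) t * (S ^ 3)⁻¹)| * 10 ^ 53 ≤ 2 ^ 580 := by
  have h1 := v_err V c hdom t S ht hS hS2
  have h2 := abs_ev_le (Gp c) t ht
  have h3 : ((l1 (Gp c) : ℝ) * l1 (Vres V c) * 10 ^ 53) ≤ 2 ^ 940 := by exact_mod_cast hle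
  have e : ev (Gp c) t * ev V t - 2 ^ 360 * (ev (Gp c) t * (S ^ 3)⁻¹) =
    ev (Gp c) t * (ev V t - 2 ^ 360 * (S ^ 3)⁻¹) := by ring
  have h5 : (2 : ℝ) ^ 940 = 2 ^ 360 * 2 ^ 580 := by rw [← pow_add]
  rw [h5] at h3
  rw [e]
  exact G_err_aux _ _ _ _ _ _ (by positivity) h2 h1 h3

/-- The derivative of the residual is tiny. -/
theorem resid_bound (t S0 S1 S2 : ℝ) (ht : |t| ≤ 1) (h0 : 1 ≤ S0) (h1 : 1 ≤ S1) (h2 : 1 ≤ S2)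
    (e0 : S0 ^ 2 = 6 + 2 * t) (e1 : S1 ^ 2 = 10 + 2 * t) (e2 : S2 ^ 2 = 14 + 2 * t) :
    |(ev Kp (S0 ^ 2) * (S0 ^ 3)⁻¹ + 4 * ev (pder Bp) (S0 ^ 2)) +
      (ev Kp (S1 ^ 2) * (S1 ^ 3)⁻¹ + 4 * ev (pder Bp) (S1 ^ 2)) +
      (ev Kp (S2 ^ 2) * (S2 ^ 3)⁻¹ + 4 * ev (pder Bp) (S2 ^ 2)) - 2 * ev (pder hp) t| * 10 ^ 52
      ≤ 2 ^ 220 := by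
  have a0 := G_err V0 6 dom_V0 Vres0_le t S0 ht h0 (by rw [e0]; norm_num)
  have a1 := G_err V1 10 dom_V1 Vres1_le t S1 ht h1 (by rw [e1]; norm_num)
  have a2 := G_err V2 14 dom_V2 Vres2_le t S2 ht h2 (by rw [e2]; norm_num)
  have a3 := abs_ev_le Eres t ht
  have a4 : ((l1 Eres : ℝ) * 10 ^ 54) ≤ 2 ^ 580 := by exact_mod_cast Eres_le
  have g0 : ev (Gp 6) t = ev Kp (S0 ^ 2) := by rw [Gp, ev_pcomp, e0]; norm_num
  have g1 : ev (Gp 10) t = ev Kp (S1 ^ 2) := by rw [Gp, ev_pcomp, e1]; norm_num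
  have g2 : ev (Gp 14) t = ev Kp (S2 ^ 2) := by rw [Gp, ev_pcomp, e2]; norm_num
  have b0 : ev (Bq 6) t = ev (pder Bp) (S0 ^ 2) := by rw [Bq, ev_pcomp, e0]; norm_num
  have b1 : ev (Bq 10) t = ev (pder Bp) (S1 ^ 2) := by rw [Bq, ev_pcomp, e1]; norm_num
  have b2 : ev (Bq 14) t = ev (pder Bp) (S2 ^ 2) := by rw [Bq, ev_pcomp, e2]; norm_num
  have hE : ev Eres t = ev (Gp 6) t * ev V0 t + ev (Gp 10) t * ev V1 t + ev (Gp 14) t * ev V2 t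
      + 2 ^ 360 * (4 * (ev (Bq 6) t + ev (Bq 10) t + ev (Bq 14) t) - 2 * ev (pder hp) t) := by
    simp only [Eres, ev_padd, ev_pmul, ev_psmul]
    push_cast
    ring
  rw [hE] at a3
  rw [← g0, ← g1, ← g2, ← b0, ← b1, ← b2]
  have h5 : (2 : ℝ) ^ 580 = 2 ^ 360 * 2 ^ 220 := by rw [← pow_add]
  have h6 : (0 : ℝ) < 2 ^ 360 := by positivity
  rw [h5] at a0 a1 a2 a4
  generalize (2 : ℝ) ^ 360 = z at *
  generalize (2 : ℝ) ^ 220 = y at *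
  refine le_of_mul_le_mul_left ?_ h6
  have key : ∀ X P0 P1 P2 Y : ℝ, z * X = Y - P0 - P1 - P2 →
      z * (|X| * 10 ^ 52) ≤ (|Y| + |P0| + |P1| + |P2|) * 10 ^ 52 := by
    intro X P0 P1 P2 Y h
    have : z * |X| = |z * X| := by rw [abs_mul, abs_of_pos h6]
    rw [← mul_assoc, this, h]
    have := abs_sub (Y - P0 - P1) P2
    have := abs_sub (Y - P0) P1
    have := abs_sub Y P0
    gcongr
    linarith
  refine (key _ (ev (Gp 6) t * ev V0 t - z * (ev (Gp 6) t * (S0 ^ 3)⁻¹))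
    (ev (Gp 10) t * ev V1 t - z * (ev (Gp 10) t * (S1 ^ 3)⁻¹))
    (ev (Gp 14) t * ev V2 t - z * (ev (Gp 14) t * (S2 ^ 3)⁻¹))
    (ev (Gp 6) t * ev V0 t + ev (Gp 10) t * ev V1 t + ev (Gp 14) t * ev V2 t
      + z * (4 * (ev (Bq 6) t + ev (Bq 10) t + ev (Bq 14) t) - 2 * ev (pder hp) t)) ?_).trans ?_
  · ring
  · have aa3 := (mul_le_mul_of_nonneg_right a3 (by positivity : (0 : ℝ) ≤ 10 ^ 54)).trans a4
    have hzy : 0 ≤ z * y := le_trans (by positivity) a4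
    linarith only [a0, a1, a2, aa3, hzy]

/-! ### The transfer operator -/

/-- Inverse branches. -/
noncomputable def br (k x : ℝ) : ℝ := √(x + 1 + k) - 1
/-- Derivatives of the inverse branches. -/
noncomputable def dbr (k x : ℝ) : ℝ := 1 / (2 * √(x + 1 + k))
/-- The transfer operator. -/
noncomputable def P (f : ℝ → ℝ) (x : ℝ) : ℝ :=
  dbr 0 x * f (br 0 x) + dbr 1 x * f (br 1 x) + dbr 2 x * f (br 2 x)

/-- The unit interval. -/
def J : Set ℝ := Set.Ico 0 1

theorem measJ : MeasurableSet J := measurableSet_Ico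

theorem sqrt_bounds : (1.4 : ℝ) ≤ √2 ∧ √2 ≤ 1.5 ∧ (1.7 : ℝ) ≤ √3 ∧ √3 ≤ 1.8 := by
  refine ⟨?_, ?_, ?_, ?_⟩
  · apply Real.le_sqrt_of_sq_le; norm_num
  · apply Real.sqrt_le_iff.2; norm_num
  · apply Real.le_sqrt_of_sq_le; norm_num
  · apply Real.sqrt_le_iff.2; norm_num

theorem image_br (k : ℝ) (hk : 0 ≤ k) :
    br k '' J = Set.Ico (√(1 + k) - 1) (√(2 + k) - 1) := by
  ext y
  simp only [J, Set.mem_image, Set.mem_Ico, br]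
  constructor
  · rintro ⟨x, ⟨h0, h1⟩, rfl⟩
    refine ⟨?_, ?_⟩
    · have := Real.sqrt_le_sqrt (show 1 + k ≤ x + 1 + k by linarith)
      linarith
    · have := Real.sqrt_lt_sqrt (show 0 ≤ x + 1 + k by linarith) (show x + 1 + k < 2 + k by linarith)
      linarith
  · rintro ⟨h0, h1⟩
    have hy : 0 ≤ y + 1 := by have := Real.sqrt_nonneg (1 + k); linarith
    refine ⟨(y + 1) ^ 2 - 1 - k, ⟨?_, ?_⟩, ?_⟩
    · have : √(1 + k) ≤ y + 1 := by linarith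
      have := (Real.sqrt_le_left hy).1 this
      linarith
    · have : y + 1 < √(2 + k) := by linarith
      have := (Real.lt_sqrt hy).1 this
      linarith
    · rw [show (y + 1) ^ 2 - 1 - k + 1 + k = (y + 1) ^ 2 by ring, Real.sqrt_sq hy]
      ring

theorem br_hasDeriv (k : ℝ) (hk : 0 ≤ k) (x : ℝ) (hx : x ∈ J) :
    HasDerivWithinAt (br k) (dbr k x) J x := by
  have hx0 : x + 1 + k ≠ 0 := by have := hx.1; positivity
  have h := (((hasDerivAt_id x).add_const 1).add_const k).sqrt hx0
  exact (h.sub_const 1).hasDerivWithinAt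

theorem br_injOn (k : ℝ) (hk : 0 ≤ k) : Set.InjOn (br k) J := by
  intro x hx y hy h
  have hx0 := hx.1
  have hy0 := hy.1
  simp only [br, sub_left_inj] at h
  have := (Real.sqrt_inj (by positivity) (by positivity)).1 h
  linarith

theorem dbr_nonneg (k x : ℝ) : 0 ≤ dbr k x := by unfold dbr; positivity

theorem J_split : J = br 0 '' J ∪ (br 1 '' J ∪ br 2 '' J) := by
  rw [image_br 0 le_rfl, image_br 1 zero_le_one, image_br 2 zero_le_two]
  obtain ⟨a, b, c, d⟩ := sqrt_bounds
  have h4 : √(2 + 2 : ℝ) = 2 := by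
    rw [show (2 + 2 : ℝ) = 2 ^ 2 by norm_num]; exact Real.sqrt_sq (by norm_num)
  rw [h4]
  norm_num
  rw [Set.Ico_union_Ico_eq_Ico (by linarith) (by linarith),
    Set.Ico_union_Ico_eq_Ico (by linarith) (by linarith)]
  rfl

theorem br_mem (k : ℝ) (hk : k = 0 ∨ k = 1 ∨ k = 2) {x : ℝ} (hx : x ∈ J) : br k x ∈ J := by
  rw [J_split]
  rcases hk with rfl | rfl | rfl
  · exact Or.inl ⟨x, hx, rfl⟩
  · exact Or.inr (Or.inl ⟨x, hx, rfl⟩)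
  · exact Or.inr (Or.inr ⟨x, hx, rfl⟩)

theorem T_br (k : ℝ) (hk : k = 0 ∨ k = 1 ∨ k = 2) {x : ℝ} (hx : x ∈ J) : T (br k x) = x := by
  obtain ⟨a, b, c, d⟩ := sqrt_bounds
  have hk0 : 0 ≤ k := by rcases hk with rfl | rfl | rfl <;> norm_num
  have hm : br k x ∈ br k '' J := ⟨x, hx, rfl⟩
  rw [image_br k hk0] at hm
  have hs : (br k x + 1) ^ 2 = x + 1 + k := by
    have := hx.1
    simp only [br, sub_add_cancel]
    exact Real.sq_sqrt (by positivity)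
  obtain ⟨h1, h2⟩ := hm
  unfold T
  rcases hk with rfl | rfl | rfl
  · norm_num at h1 h2
    rw [if_pos (by linarith)]
    linarith
  · norm_num at h1 h2
    rw [if_neg (by linarith), if_pos (by linarith)]
    linarith
  · norm_num at h1 h2
    rw [if_neg (by linarith), if_neg (by linarith)]
    linarith

theorem T_mem {x : ℝ} (hx : x ∈ J) : T x ∈ J := by
  have h := hx
  rw [J_split] at h
  rcases h with ⟨y, hy, rfl⟩ | ⟨y, hy, rfl⟩ | ⟨y, hy, rfl⟩
  · rw [T_br 0 (by simp) hy]; exact hy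
  · rw [T_br 1 (by simp) hy]; exact hy
  · rw [T_br 2 (by simp) hy]; exact hy

theorem T_iter_mem (n : ℕ) {x : ℝ} (hx : x ∈ J) : T^[n] x ∈ J := by
  induction n generalizing x with
  | zero => exact hx
  | succ n ih => exact ih (T_mem hx)

theorem measT : Measurable T := by
  unfold T
  refine Measurable.ite measurableSet_Iio (by fun_prop) ?_
  exact Measurable.ite measurableSet_Iio (by fun_prop) (by fun_prop)

theorem meas_br_image (k : ℝ) (hk : 0 ≤ k) : MeasurableSet (br k '' J) := by
  rw [image_br k hk]; exact measurableSet_Ico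

theorem transfer (g f : ℝ → ℝ) (hi : IntegrableOn (fun x => g (T x) * f x) J) :
    ∫ x in J, g (T x) * f x = ∫ x in J, g x * P f x := by
  have key : ∀ k : ℝ, (k = 0 ∨ k = 1 ∨ k = 2) →
      ∫ x in br k '' J, g (T x) * f x = ∫ x in J, g x * (dbr k x * f (br k x)) ∧
      IntegrableOn (fun x => g x * (dbr k x * f (br k x))) J ∧
      IntegrableOn (fun x => g (T x) * f x) (br k '' J) := by
    intro k hk
    have hk0 : 0 ≤ k := by rcases hk with rfl | rfl | rfl <;> norm_num
    have hsub : br k '' J ⊆ J := by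
      rintro _ ⟨x, hx, rfl⟩; exact br_mem k hk hx
    have heq : Set.EqOn (fun x => |dbr k x| • (g (T (br k x)) * f (br k x)))
        (fun x => g x * (dbr k x * f (br k x))) J := by
      intro x hx
      simp only [smul_eq_mul]
      rw [T_br k hk hx, abs_of_nonneg (dbr_nonneg k x)]
      ring
    have h1 := integral_image_eq_integral_abs_deriv_smul measJ (br_hasDeriv k hk0)
      (br_injOn k hk0) (fun x => g (T x) * f x)
    have h2 := (integrableOn_image_iff_integrableOn_abs_deriv_smul measJ (br_hasDeriv k hk0)
      (br_injOn k hk0) (fun x => g (T x) * f x)).1 (hi.mono_set hsub)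
    refine ⟨?_, ?_, hi.mono_set hsub⟩
    · rw [h1]; exact setIntegral_congr_fun measJ heq
    · exact h2.congr_fun heq measJ
  obtain ⟨a0, b0, c0⟩ := key 0 (by simp)
  obtain ⟨a1, b1, c1⟩ := key 1 (by simp)
  obtain ⟨a2, b2, c2⟩ := key 2 (by simp)
  obtain ⟨q1, q2, q3, q4⟩ := sqrt_bounds
  have hd12 : Disjoint (br 1 '' J) (br 2 '' J) := by
    rw [image_br 1 zero_le_one, image_br 2 zero_le_two, Set.Ico_disjoint_Ico]
    norm_num
  have hd0 : Disjoint (br 0 '' J) (br 1 '' J ∪ br 2 '' J) := by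
    rw [Set.disjoint_union_right]
    rw [image_br 0 le_rfl, image_br 1 zero_le_one, image_br 2 zero_le_two, Set.Ico_disjoint_Ico,
      Set.Ico_disjoint_Ico]
    norm_num
  have b12 : IntegrableOn (fun x => g x * (dbr 1 x * f (br 1 x)) + g x * (dbr 2 x * f (br 2 x))) J :=
    b1.add b2
  conv_lhs => rw [J_split]
  rw [setIntegral_union hd0 ((meas_br_image 1 zero_le_one).union (meas_br_image 2 zero_le_two)) c0
    (c1.union c2), setIntegral_union hd12 (meas_br_image 2 zero_le_two) c1 c2, a0, a1, a2,
    ← integral_add b1 b2, ← integral_add b0 b12]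
  refine integral_congr_ae (Eventually.of_forall fun x => ?_)
  simp only [P]
  ring

/-- Lipschitz functions on the unit interval. -/
def Lip (L : ℝ) (f : ℝ → ℝ) : Prop := ∀ x ∈ J, ∀ y ∈ J, |f x - f y| ≤ L * |x - y|

theorem volJ : volume.real J = 1 := by simp [J]

theorem Lip.nonneg {L : ℝ} {f : ℝ → ℝ} (h : Lip L f) : 0 ≤ L := by
  have h1 := h 0 (by simp [J]) (1 / 2) (by simp [J]; norm_num)
  have h2 := (abs_nonneg _).trans h1
  norm_num at h2
  linarith

theorem Lip.bdd {L : ℝ} {f : ℝ → ℝ} (h : Lip L f) : ∀ x ∈ J, |f x| ≤ L + |f 0| := by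
  intro x hx
  have h1 := h x hx 0 (by simp [J])
  have h2 : |x - 0| ≤ 1 := by
    rw [sub_zero, abs_of_nonneg hx.1]; exact hx.2.le
  have h3 : L * |x - 0| ≤ L * 1 := by have := h.nonneg; gcongr
  have h4 := abs_sub_abs_le_abs_sub (f x) (f 0)
  linarith

theorem Lip.contOn {L : ℝ} {f : ℝ → ℝ} (h : Lip L f) : ContinuousOn f J := by
  have : LipschitzOnWith L.toNNReal f J := by
    refine LipschitzOnWith.of_dist_le_mul fun x hx y hy => ?_
    rw [Real.coe_toNNReal _ h.nonneg, Real.dist_eq, Real.dist_eq]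
    exact h x hx y hy
  exact this.continuousOn

/-- Product of a bounded measurable function and an integrable one. -/
theorem integ_mul {C : ℝ} {g f : ℝ → ℝ} (hg : Measurable g) (hC : ∀ x ∈ J, |g x| ≤ C)
    (hf : IntegrableOn f J) : IntegrableOn (fun x => g x * f x) J := by
  refine Integrable.bdd_mul (c := C) hf hg.aestronglyMeasurable ?_
  exact (ae_restrict_iff' measJ).2 (Eventually.of_forall fun x hx => hC x hx)

theorem Lip.integ {L : ℝ} {f : ℝ → ℝ} (h : Lip L f) : IntegrableOn f J := by
  refine ⟨h.contOn.aestronglyMeasurable measJ, ?_⟩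
  refine HasFiniteIntegral.restrict_of_bounded (L + |f 0|) (by simp [J]) ?_
  exact (ae_restrict_iff' measJ).2 (Eventually.of_forall fun x hx => h.bdd x hx)

theorem abs_integ_mul {C : ℝ} {g f : ℝ → ℝ} (hC : ∀ x ∈ J, |g x| ≤ C)
    (hf : IntegrableOn f J) : |∫ x in J, g x * f x| ≤ C * ∫ x in J, |f x| := by
  rw [← integral_const_mul]
  refine norm_integral_le_of_norm_le (f := fun x => g x * f x) (hf.abs.const_mul C) ?_
  refine (ae_restrict_iff' measJ).2 (Eventually.of_forall fun x hx => ?_)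
  rw [Real.norm_eq_abs, abs_mul]
  have := hC x hx
  gcongr

theorem Lip.sup {L : ℝ} {f : ℝ → ℝ} (h : Lip L f) (h0 : ∫ x in J, f x = 0) :
    ∀ x ∈ J, |f x| ≤ L := by
  intro x hx
  have h1 : f x = ∫ y in J, (f x - f y) := by
    rw [integral_sub (by simp [J]) h.integ, h0]
    simp [volJ]
  rw [h1]
  have := norm_setIntegral_le_of_norm_le_const (μ := volume) (s := J) (f := fun y => f x - f y)
    (C := L) (by simp [J]) (fun y hy => by
      refine (h x hx y hy).trans ?_
      have h3 : |x - y| ≤ 1 := by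
        rw [abs_le]
        constructor <;> linarith [hx.1, hx.2, hy.1, hy.2]
      have := h.nonneg
      nlinarith)
  rwa [volJ, mul_one] at this

theorem branch_lip (k m : ℝ) (hk : k = 0 ∨ k = 1 ∨ k = 2) (hm : 0 < m) (hmk : m ^ 2 ≤ 1 + k)
    {L : ℝ} {f : ℝ → ℝ} (h : Lip L f) (hs : ∀ x ∈ J, |f x| ≤ L) (x : ℝ) (hx : x ∈ J)
    (y : ℝ) (hy : y ∈ J) :
    |dbr k x * f (br k x) - dbr k y * f (br k y)| ≤
      (1 / (4 * m ^ 2) + 1 / (4 * m ^ 3)) * L * |x - y| := by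
  have hL := h.nonneg
  have hk0 : 0 ≤ k := by rcases hk with rfl | rfl | rfl <;> norm_num
  have e1 := h (br k x) (br_mem k hk hx) (br k y) (br_mem k hk hy)
  have e2 := hs (br k y) (br_mem k hk hy)
  have hx0 := hx.1
  have hy0 := hy.1
  have ha : m ≤ √(x + 1 + k) := Real.le_sqrt_of_sq_le (by linarith)
  have hb : m ≤ √(y + 1 + k) := Real.le_sqrt_of_sq_le (by linarith)
  have ha2 : √(x + 1 + k) ^ 2 = x + 1 + k := Real.sq_sqrt (by positivity)
  have hb2 : √(y + 1 + k) ^ 2 = y + 1 + k := Real.sq_sqrt (by positivity)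
  have hdb : |br k x - br k y| = |√(x + 1 + k) - √(y + 1 + k)| := by
    unfold br; congr 1; ring
  rw [hdb] at e1
  unfold dbr at *
  generalize f (br k x) = u at *
  generalize f (br k y) = v at *
  generalize √(x + 1 + k) = a at *
  generalize √(y + 1 + k) = b at *
  have hxy : |x - y| = |a - b| * (a + b) := by
    rw [← abs_of_pos (show 0 < a + b by linarith), ← abs_mul]
    congr 1
    linarith
  have ha0 : 0 < a := by linarith
  have hb0 : 0 < b := by linarith
  have hab : |a - b| ≤ |x - y| / (2 * m) := by
    rw [hxy, le_div_iff₀ (by positivity)]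
    have := abs_nonneg (a - b)
    gcongr
    linarith
  have hinv : |1 / (2 * a) - 1 / (2 * b)| ≤ |x - y| / (4 * m ^ 3) := by
    have : 1 / (2 * a) - 1 / (2 * b) = -(a - b) / (2 * a * b) := by field_simp; ring
    rw [this, abs_div, abs_neg, abs_of_pos (show 0 < 2 * a * b by positivity)]
    calc |a - b| / (2 * a * b) ≤ |a - b| / (2 * m * m) := by gcongr
      _ ≤ (|x - y| / (2 * m)) / (2 * m * m) := by gcongr
      _ = |x - y| / (4 * m ^ 3) := by field_simp; ring
  have hsplit : 1 / (2 * a) * u - 1 / (2 * b) * v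
      = 1 / (2 * a) * (u - v) + (1 / (2 * a) - 1 / (2 * b)) * v := by ring
  rw [hsplit]
  refine (abs_add_le _ _).trans ?_
  rw [abs_mul, abs_mul, abs_of_pos (show 0 < 1 / (2 * a) by positivity)]
  have t1 : 1 / (2 * a) * |u - v| ≤ 1 / (2 * m) * (L * (|x - y| / (2 * m))) := by
    have : |u - v| ≤ L * (|x - y| / (2 * m)) := e1.trans (by gcongr)
    gcongr
  have t2 : |1 / (2 * a) - 1 / (2 * b)| * |v| ≤ |x - y| / (4 * m ^ 3) * L := by gcongr
  refine (add_le_add t1 t2).trans (le_of_eq ?_)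
  field_simp
  ring

theorem Lip.P {L : ℝ} {f : ℝ → ℝ} (h : Lip L f) (hs : ∀ x ∈ J, |f x| ≤ L) :
    Lip (9 / 10 * L) (P f) := by
  intro x hx y hy
  have hL := h.nonneg
  have a0 := branch_lip 0 1 (by simp) (by norm_num) (by norm_num) h hs x hx y hy
  have a1 := branch_lip 1 1.4 (by simp) (by norm_num) (by norm_num) h hs x hx y hy
  have a2 := branch_lip 2 1.7 (by simp) (by norm_num) (by norm_num) h hs x hx y hy
  unfold BR.P
  have e : dbr 0 x * f (br 0 x) + dbr 1 x * f (br 1 x) + dbr 2 x * f (br 2 x) -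
      (dbr 0 y * f (br 0 y) + dbr 1 y * f (br 1 y) + dbr 2 y * f (br 2 y)) =
      (dbr 0 x * f (br 0 x) - dbr 0 y * f (br 0 y)) + (dbr 1 x * f (br 1 x) - dbr 1 y * f (br 1 y))
      + (dbr 2 x * f (br 2 x) - dbr 2 y * f (br 2 y)) := by ring
  rw [e]
  refine (abs_add_three _ _ _).trans ?_
  have hz : 0 ≤ L * |x - y| := by positivity
  norm_num at a0 a1 a2
  rw [mul_assoc] at a0 a1 a2 ⊢
  linarith

theorem integral_P {f : ℝ → ℝ} (hf : IntegrableOn f J) : ∫ x in J, P f x = ∫ x in J, f x := by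
  have := transfer (fun _ => 1) f (by simpa using hf)
  simpa using this.symm

theorem iter_bdd {C : ℝ} {g : ℝ → ℝ} (hC : ∀ x ∈ J, |g x| ≤ C) (n : ℕ) :
    ∀ x ∈ J, |g (T^[n] x)| ≤ C := fun x hx => hC _ (T_iter_mem n hx)

theorem iter_transfer {C : ℝ} {g f : ℝ → ℝ} (hg : Measurable g) (hC : ∀ x ∈ J, |g x| ≤ C)
    (hf : IntegrableOn f J) (n : ℕ) :
    ∫ x in J, g (T^[n + 1] x) * f x = ∫ x in J, g (T^[n] x) * P f x := by
  have hm : Measurable (fun x => g (T^[n + 1] x)) := hg.comp (measT.iterate _)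
  exact transfer (fun x => g (T^[n] x)) f (integ_mul hm (iter_bdd hC (n + 1)) hf)

theorem decay {C : ℝ} {g : ℝ → ℝ} (hg : Measurable g) (hC : ∀ x ∈ J, |g x| ≤ C) (n : ℕ)
    {L : ℝ} {f : ℝ → ℝ} (h : Lip L f) (h0 : ∫ x in J, f x = 0) :
    |∫ x in J, g (T^[n] x) * f x| ≤ C * ((9 / 10) ^ n * L) := by
  induction n generalizing f L with
  | zero =>
    have hs := h.sup h0
    have hC0 : 0 ≤ C := (abs_nonneg _).trans (hC 0 (by simp [J]))
    have := norm_setIntegral_le_of_norm_le_const (μ := volume) (s := J)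
      (f := fun y => g y * f y) (C := C * L) (by simp [J]) (fun y hy => by
        rw [Real.norm_eq_abs, abs_mul]
        have := hC y hy
        have := hs y hy
        gcongr)
    rw [volJ, mul_one] at this
    simpa using this
  | succ n ih =>
    rw [iter_transfer hg hC h.integ]
    refine (ih (h.P (h.sup h0)) (by rw [integral_P h.integ, h0])).trans (le_of_eq ?_)
    ring

theorem lip_of_deriv {f f' : ℝ → ℝ} {L : ℝ} (h : ∀ x ∈ J, HasDerivAt f (f' x) x)
    (hb : ∀ x ∈ J, |f' x| ≤ L) : Lip L f := by
  intro x hx y hy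
  exact Convex.norm_image_sub_le_of_norm_hasDerivWithin_le (s := J)
    (fun z hz => (h z hz).hasDerivWithinAt) hb (convex_Ico 0 1) hy hx

theorem lip_of_cont_deriv {f f' : ℝ → ℝ} (h : ∀ x, HasDerivAt f (f' x) x)
    (hc : Continuous f') : ∃ L, Lip L f := by
  obtain ⟨L, hL⟩ := (isCompact_Icc (a := (0 : ℝ)) (b := 1)).exists_bound_of_continuousOn
    hc.continuousOn
  exact ⟨L, lip_of_deriv (fun x _ => h x) fun x hx => hL x ⟨hx.1, hx.2.le⟩⟩

theorem lip_approx {ρ : ℝ → ℝ} (hρ : Integrable ρ) {δ : ℝ} (hδ : 0 < δ) :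
    ∃ p L, Lip L p ∧ ∫ x in J, |ρ x - p x| ≤ δ := by
  obtain ⟨g, -, hg1, hg2, hg3⟩ := hρ.exists_hasCompactSupport_integral_sub_le (half_pos hδ)
  obtain ⟨q, hq⟩ := exists_polynomial_near_of_continuousOn 0 1 g hg2.continuousOn (δ / 2)
    (half_pos hδ)
  obtain ⟨L, hL⟩ := lip_of_cont_deriv (f := fun x => q.eval x) (fun x => q.hasDerivAt x)
    (Polynomial.continuous _)
  refine ⟨fun x => q.eval x, L, hL, ?_⟩
  have i1 : IntegrableOn (fun x => |ρ x - g x|) J := (hρ.sub hg3).abs.integrableOn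
  have i2 : IntegrableOn (fun _ : ℝ => δ / 2) J := by simp [J]
  have i3 : IntegrableOn (fun x => |ρ x - q.eval x|) J := (hρ.integrableOn.sub hL.integ).abs
  calc ∫ x in J, |ρ x - q.eval x| ≤ ∫ x in J, (|ρ x - g x| + δ / 2) := by
        refine setIntegral_mono_on i3 (i1.add i2) measJ fun x hx => ?_
        have h1 := hq x ⟨hx.1, hx.2.le⟩
        have h2 := abs_sub_le (ρ x) (g x) (q.eval x)
        rw [abs_sub_comm (g x)] at h2
        linarith
    _ = (∫ x in J, |ρ x - g x|) + δ / 2 := by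
        rw [integral_add i1 i2]; simp [volJ]
    _ ≤ (∫ x, |ρ x - g x|) + δ / 2 := by
        have : ∫ x in J, |ρ x - g x| ≤ ∫ x, |ρ x - g x| :=
          setIntegral_le_integral (hρ.sub hg3).abs (Eventually.of_forall fun x => abs_nonneg _)
        linarith
    _ ≤ δ := by
        have : (∫ x, |ρ x - g x|) ≤ δ / 2 := hg1
        linarith

theorem integral_mu_eq (μ : Measure ℝ) [IsProbabilityMeasure μ]
    (hsupp : μ (Set.Ico (0 : ℝ) 1)ᶜ = 0) (hac : μ ≪ volume) (G : ℝ → ℝ) :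
    ∫ x, G x ∂μ = ∫ x in J, G x * (μ.rnDeriv volume x).toReal := by
  have h1 : ∫ x, G x ∂μ = ∫ x, J.indicator G x ∂μ := by
    refine integral_congr_ae ?_
    have : ∀ᵐ x ∂μ, x ∈ J := by
      rw [ae_iff]; exact hsupp
    filter_upwards [this] with x hx
    rw [Set.indicator_of_mem hx]
  rw [h1, ← integral_rnDeriv_smul hac, ← integral_indicator measJ]
  refine integral_congr_ae (Eventually.of_forall fun x => ?_)
  by_cases hx : x ∈ J
  · simp [Set.indicator_of_mem hx, mul_comm]
  · simp [Set.indicator_of_notMem hx]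

theorem integral_iter (μ : Measure ℝ) [IsProbabilityMeasure μ]
    (hinv : ∀ A : Set ℝ, MeasurableSet A → μ (T ⁻¹' A) = μ A) {g : ℝ → ℝ} (hg : Measurable g)
    (n : ℕ) : ∫ x, g (T^[n] x) ∂μ = ∫ x, g x ∂μ := by
  have hp : MeasurePreserving T μ μ := ⟨measT, Measure.ext fun A hA => by
    rw [Measure.map_apply measT hA]; exact hinv A hA⟩
  have hn := hp.iterate n
  conv_rhs => rw [← hn.map_eq]
  rw [integral_map hn.measurable.aemeasurable hg.aestronglyMeasurable]

theorem acim_bound (μ : Measure ℝ) [IsProbabilityMeasure μ]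
    (hsupp : μ (Set.Ico (0 : ℝ) 1)ᶜ = 0)
    (hinv : ∀ A : Set ℝ, MeasurableSet A → μ (T ⁻¹' A) = μ A) (hac : μ ≪ volume)
    {C : ℝ} {g : ℝ → ℝ} (hg : Measurable g) (hC : ∀ x ∈ J, |g x| ≤ C)
    {h : ℝ → ℝ} {L ε : ℝ} (hl : Lip L h) (hr : Lip ε (fun x => P h x - h x)) :
    |(∫ x in J, h x) * (∫ x, g x ∂μ) - ∫ x in J, g x * h x| ≤ 10 * C * ε := by
  have hC0 : 0 ≤ C := (abs_nonneg _).trans (hC 0 (by simp [J]))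
  have hε := hr.nonneg
  have hgn : ∀ n, Measurable (fun x => g (T^[n] x)) := fun n => hg.comp (measT.iterate n)
  set m := ∫ x in J, h x with hm
  set a : ℕ → ℝ := fun n => ∫ x in J, g (T^[n] x) * h x with ha
  have hPi : IntegrableOn (P h) J := by
    have := hr.integ.add hl.integ
    refine this.congr_fun (fun x _ => ?_) measJ
    simp
  have hr0 : ∫ x in J, (P h x - h x) = 0 := by
    rw [integral_sub hPi hl.integ, integral_P hl.integ, sub_self]
  have step : ∀ n, |a (n + 1) - a n| ≤ C * ((9 / 10) ^ n * ε) := by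
    intro n
    have e : a (n + 1) - a n = ∫ x in J, g (T^[n] x) * (P h x - h x) := by
      simp only [ha]
      rw [iter_transfer hg hC hl.integ, ← integral_sub (integ_mul (hgn n) (iter_bdd hC n) hPi)
        (integ_mul (hgn n) (iter_bdd hC n) hl.integ)]
      refine integral_congr_ae (Eventually.of_forall fun x => ?_)
      ring
    rw [e]
    exact decay hg hC n hr hr0
  have tot : ∀ n, |a n - a 0| ≤ 10 * C * ε * (1 - (9 / 10) ^ n) := by
    intro n
    induction n with
    | zero => simp
    | succ n ih =>
      have h1 := step n
      have h2 := abs_sub_le (a (n + 1)) (a n) (a 0)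
      rw [pow_succ]
      linarith
  have tot' : ∀ n, |a n - a 0| ≤ 10 * C * ε := by
    intro n
    refine (tot n).trans ?_
    have h1 : (0 : ℝ) ≤ (9 / 10) ^ n := by positivity
    have h2 : 0 ≤ 10 * C * ε := by positivity
    nlinarith
  set ρ : ℝ → ℝ := fun x => (μ.rnDeriv volume x).toReal with hρ
  have hρi : Integrable ρ := Measure.integrable_toReal_rnDeriv
  have hI : ∀ n, ∫ x, g x ∂μ = ∫ x in J, g (T^[n] x) * ρ x := by
    intro n
    rw [← integral_iter μ hinv hg n, integral_mu_eq μ hsupp hac]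
  have hρ1 : ∫ x in J, ρ x = 1 := by
    have := integral_mu_eq μ hsupp hac (fun _ => 1)
    simpa using this.symm
  set D := ∫ x in J, |h x| with hD
  have hD0 : 0 ≤ D := integral_nonneg fun x => abs_nonneg _
  have han : ∀ n, |a n| ≤ C * D := fun n => abs_integ_mul (iter_bdd hC n) hl.integ
  have main : ∀ δ > 0, |m * (∫ x, g x ∂μ) - a 0| ≤ 10 * C * ε + (|m| * C + C * D) * δ + δ := by
    intro δ hδ
    obtain ⟨p, Lp, hp, hpδ⟩ := lip_approx hρi hδ
    set M := ∫ x in J, p x with hM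
    have hM1 : |M - 1| ≤ δ := by
      rw [← hρ1, hM, ← integral_sub hp.integ hρi.integrableOn]
      refine (norm_integral_le_integral_norm (fun x => p x - ρ x)).trans
        (le_trans (le_of_eq ?_) hpδ)
      refine integral_congr_ae (Eventually.of_forall fun x => ?_)
      exact abs_sub_comm _ _
    have hf : Lip (|m| * Lp + |M| * L) (fun x => m * p x - M * h x) := by
      intro x hx y hy
      have e : m * p x - M * h x - (m * p y - M * h y) = m * (p x - p y) - M * (h x - h y) := by
        ring
      rw [e]
      refine (abs_sub _ _).trans ?_
      rw [abs_mul, abs_mul]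
      have h1 := hp x hx y hy
      have h2 := hl x hx y hy
      calc |m| * |p x - p y| + |M| * |h x - h y| ≤ |m| * (Lp * |x - y|) + |M| * (L * |x - y|) := by
            gcongr
        _ = _ := by ring
    have hf0 : ∫ x in J, (m * p x - M * h x) = 0 := by
      rw [integral_sub (hp.integ.const_mul m) (hl.integ.const_mul M), integral_const_mul,
        integral_const_mul, ← hM, ← hm]
      ring
    have hlim : Tendsto (fun n : ℕ => C * ((9 / 10 : ℝ) ^ n * (|m| * Lp + |M| * L))) atTop
        (nhds (C * (0 * (|m| * Lp + |M| * L)))) :=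
      ((tendsto_pow_atTop_nhds_zero_of_lt_one (by norm_num) (by norm_num)).mul_const _).const_mul _
    rw [zero_mul, mul_zero] at hlim
    obtain ⟨n, hn⟩ := (hlim.eventually (gt_mem_nhds hδ)).exists
    have d1 := decay hg hC n hf hf0
    have d2 : |∫ x in J, g (T^[n] x) * (ρ x - p x)| ≤ C * δ :=
      (abs_integ_mul (iter_bdd hC n) (hρi.integrableOn.sub hp.integ)).trans
        (mul_le_mul_of_nonneg_left hpδ hC0)
    have iρ := integ_mul (hgn n) (iter_bdd hC n) hρi.integrableOn
    have ip := integ_mul (hgn n) (iter_bdd hC n) hp.integ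
    have ih := integ_mul (hgn n) (iter_bdd hC n) hl.integ
    have e1 : ∫ x in J, g (T^[n] x) * (ρ x - p x) =
        (∫ x in J, g (T^[n] x) * ρ x) - ∫ x in J, g (T^[n] x) * p x := by
      rw [← integral_sub iρ ip]
      refine integral_congr_ae (Eventually.of_forall fun x => ?_)
      ring
    have e2 : ∫ x in J, g (T^[n] x) * (m * p x - M * h x) =
        m * (∫ x in J, g (T^[n] x) * p x) - M * a n := by
      rw [ha, ← integral_const_mul, ← integral_const_mul,
        ← integral_sub (ip.const_mul m) (ih.const_mul M)]
      refine integral_congr_ae (Eventually.of_forall fun x => ?_)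
      ring
    rw [e1] at d2
    rw [e2] at d1
    rw [hI n]
    generalize (∫ x in J, g (T^[n] x) * ρ x) = X at *
    generalize (∫ x in J, g (T^[n] x) * p x) = Y at *
    have e3 : m * X - a 0 = m * (X - Y) + (m * Y - M * a n) + (M - 1) * a n + (a n - a 0) := by
      ring
    have t1 : |m * (X - Y)| ≤ |m| * (C * δ) := by rw [abs_mul]; gcongr
    have t2 : |(M - 1) * a n| ≤ δ * (C * D) := by
      rw [abs_mul]
      have := han n
      gcongr
    rw [e3]
    have s1 := abs_add_le (m * (X - Y) + (m * Y - M * a n) + (M - 1) * a n) (a n - a 0)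
    have s2 := abs_add_three (m * (X - Y)) (m * Y - M * a n) ((M - 1) * a n)
    have s3 := tot' n
    linarith
  have ha0 : a 0 = ∫ x in J, g x * h x := rfl
  rw [← ha0]
  refine le_of_forall_pos_le_add fun η hη => ?_
  set K := |m| * C + C * D + 1 with hK
  have hKpos : 0 < K := by positivity
  have := main (η / K) (by positivity)
  have e : (|m| * C + C * D) * (η / K) + η / K = η := by
    have : (|m| * C + C * D) * (η / K) + η / K = K * (η / K) := by rw [hK]; ring
    rw [this]; field_simp
  linarith

/-- Integer evaluation. -/
noncomputable def iev : List ℤ → ℤ → ℤ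
  | [], _ => 0
  | a :: l, n => a + n * iev l n

theorem ev_iev (l : List ℤ) (n : ℤ) : ev l (n : ℝ) = (iev l n : ℤ) := by
  induction l with
  | nil => simp [ev, iev]
  | cons a l ih => rw [ev, iev, ih]; push_cast; ring

theorem Hp_one : iev Hp 1 = 6188495434440233445232091092805398125679704931443099060068066430256 := by decide +kernel
theorem Hp_neg : iev Hp (-1) = 4503498767743318458065402649866671208577383405034313279999090787704 := by decide +kernel
theorem Q_one : iev Q 1 = 1669144870502422439416022945914864738870435147114678371385981766391 := by decide +kernel
theorem Q_neg : iev Q (-1) = (-2008459971760464927042463018896722382276361857393826533432842265725) := by decide +kernel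

/-- The approximate density. -/
noncomputable def hd (x : ℝ) : ℝ := ev hp (2 * x - 1)

theorem ev_hp (t : ℝ) : ev hp t = 2 * ev (pder Hp) t := by
  rw [hp, ev_psmul]; norm_num

theorem ev_Hp (t : ℝ) : ev Hp t = (3 + t) * ev Q1 t := by
  rw [Hp, ev_pmul]; simp [ev_cons, ev_nil]

theorem ev_Kp (w : ℝ) : ev Kp w = 4 * (w * ev (pder Ap) w) - 2 * ev Ap w := by
  rw [Kp, ev_padd, ev_psmul, ev_psmul, ev_cons]; push_cast; ring

theorem hasDerivAt_ev_lin (l : List ℤ) (x : ℝ) :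
    HasDerivAt (fun x : ℝ => ev l (2 * x - 1)) (2 * ev (pder l) (2 * x - 1)) x := by
  have h1 : HasDerivAt (fun x : ℝ => 2 * x - 1) 2 x := by
    simpa using ((hasDerivAt_id x).const_mul 2).sub_const 1
  have := (hasDerivAt_ev l (2 * x - 1)).comp x h1
  rw [mul_comm]
  exact this

theorem lip_hd : ∃ L, Lip L hd :=
  lip_of_cont_deriv (f := hd) (fun x => hasDerivAt_ev_lin hp x)
    (continuous_const.mul ((continuous_ev _).comp (by fun_prop)))

/-- One branch of the transfer operator applied to the density. -/
noncomputable def Fb (k x : ℝ) : ℝ :=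
  ev Ap (4 * (x + 1 + k)) / (2 * √(x + 1 + k)) + ev Bp (4 * (x + 1 + k))

theorem Fb_eq (k x : ℝ) (hx : 0 < x + 1 + k) : dbr k x * hd (br k x) = Fb k x := by
  have hs : 0 < √(x + 1 + k) := Real.sqrt_pos.2 hx
  have h1 : hd (br k x) = ev gp (2 * √(x + 1 + k)) := by
    rw [gp, ev_pcomp, hd, br]; congr 1; push_cast; ring
  have h2 : (2 * √(x + 1 + k)) ^ 2 = 4 * (x + 1 + k) := by
    rw [mul_pow, Real.sq_sqrt hx.le]; norm_num
  rw [h1, ev_split, h2, dbr, Fb, Ap, Bp]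
  field_simp

theorem Fb_deriv (k x : ℝ) (hx : 0 < x + 1 + k) :
    HasDerivAt (Fb k) (ev Kp ((2 * √(x + 1 + k)) ^ 2) * ((2 * √(x + 1 + k)) ^ 3)⁻¹ +
      4 * ev (pder Bp) ((2 * √(x + 1 + k)) ^ 2)) x := by
  have hs : 0 < √(x + 1 + k) := Real.sqrt_pos.2 hx
  have h2 : (2 * √(x + 1 + k)) ^ 2 = 4 * (x + 1 + k) := by
    rw [mul_pow, Real.sq_sqrt hx.le]; norm_num
  have d0 : HasDerivAt (fun x : ℝ => x + 1 + k) 1 x :=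
    ((hasDerivAt_id x).add_const 1).add_const k
  have d1 : HasDerivAt (fun x : ℝ => 4 * (x + 1 + k)) 4 x := by
    simpa using d0.const_mul 4
  have d2 : HasDerivAt (fun x : ℝ => 2 * √(x + 1 + k)) (2 * (1 / (2 * √(x + 1 + k)))) x :=
    (d0.sqrt hx.ne').const_mul 2
  have dA := (hasDerivAt_ev Ap (4 * (x + 1 + k))).comp x d1
  have dB := (hasDerivAt_ev Bp (4 * (x + 1 + k))).comp x d1
  have := (dA.div d2 (by positivity)).add dB
  refine this.congr_deriv ?_
  simp only [Function.comp]
  rw [ev_Kp, h2]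
  have h3 : 4 * (x + 1 + k) = 4 * √(x + 1 + k) ^ 2 := by rw [Real.sq_sqrt hx.le]
  generalize ev (pder Ap) (4 * (x + 1 + k)) = A'
  generalize ev Ap (4 * (x + 1 + k)) = A
  generalize ev (pder Bp) (4 * (x + 1 + k)) = B'
  rw [h3]
  generalize √(x + 1 + k) = s at *
  field_simp
  ring

theorem lip_resid : Lip (2 ^ 220 / 10 ^ 52) (fun x => P hd x - hd x) := by
  have hL : Lip (2 ^ 220 / 10 ^ 52) (fun x => Fb 0 x + Fb 1 x + Fb 2 x - hd x) := by
    refine lip_of_deriv (fun x hx => ?_) (fun x hx => ?_)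
      (f' := fun x => (ev Kp ((2 * √(x + 1 + 0)) ^ 2) * ((2 * √(x + 1 + 0)) ^ 3)⁻¹ +
        4 * ev (pder Bp) ((2 * √(x + 1 + 0)) ^ 2)) +
        (ev Kp ((2 * √(x + 1 + 1)) ^ 2) * ((2 * √(x + 1 + 1)) ^ 3)⁻¹ +
        4 * ev (pder Bp) ((2 * √(x + 1 + 1)) ^ 2)) +
        (ev Kp ((2 * √(x + 1 + 2)) ^ 2) * ((2 * √(x + 1 + 2)) ^ 3)⁻¹ +
        4 * ev (pder Bp) ((2 * √(x + 1 + 2)) ^ 2)) - 2 * ev (pder hp) (2 * x - 1))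
    · have hx0 := hx.1
      exact (((Fb_deriv 0 x (by positivity)).add (Fb_deriv 1 x (by positivity))).add
        (Fb_deriv 2 x (by positivity))).sub (hasDerivAt_ev_lin hp x)
    · have hx0 := hx.1
      have hx1 := hx.2
      rw [le_div_iff₀ (by positivity)]
      have hS : ∀ k : ℝ, 0 ≤ k → 1 ≤ 2 * √(x + 1 + k) := by
        intro k hk
        have : 1 ≤ √(x + 1 + k) := Real.le_sqrt_of_sq_le (by linarith)
        linarith
      have hS2 : ∀ k : ℝ, 0 ≤ k → (2 * √(x + 1 + k)) ^ 2 = (6 + 4 * k) + 2 * (2 * x - 1) := by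
        intro k hk
        rw [mul_pow, Real.sq_sqrt (by positivity)]
        ring
      refine resid_bound (2 * x - 1) _ _ _ ?_ (hS 0 le_rfl) (hS 1 zero_le_one) (hS 2 zero_le_two)
        ?_ ?_ ?_
      · rw [abs_le]; constructor <;> linarith
      · rw [hS2 0 le_rfl]; norm_num
      · rw [hS2 1 zero_le_one]; norm_num
      · rw [hS2 2 zero_le_two]; norm_num
  have heq : ∀ x ∈ J, P hd x - hd x = Fb 0 x + Fb 1 x + Fb 2 x - hd x := by
    intro x hx
    have hx0 := hx.1
    rw [P, Fb_eq 0 x (by positivity), Fb_eq 1 x (by positivity), Fb_eq 2 x (by positivity)]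
  intro x hx y hy
  simp only [heq x hx, heq y hy]
  exact hL x hx y hy

theorem int_J (f : ℝ → ℝ) : ∫ x in J, f x = ∫ x in (0 : ℝ)..1, f x := by
  rw [J, integral_Ico_eq_integral_Ioc, intervalIntegral.integral_of_le zero_le_one]

theorem cont_hd : Continuous hd := (continuous_ev _).comp (by fun_prop)

theorem int_hd : ∫ x in J, hd x = ev Hp 1 - ev Hp (-1) := by
  rw [int_J, intervalIntegral.integral_eq_sub_of_hasDerivAt
    (f := fun x => ev Hp (2 * x - 1)) (fun x _ => ?_) (cont_hd.intervalIntegrable _ _)]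
  · norm_num
  · rw [hd, ev_hp]; exact hasDerivAt_ev_lin Hp x

theorem int_log_hd : ∫ x in J, Real.log (2 * x + 2) * hd x =
    (2 * ev Hp 1 - ev Hp (-1)) * Real.log 2 - (ev Q 1 - ev Q (-1)) := by
  have hpos : ∀ x ∈ Set.uIcc (0 : ℝ) 1, 0 < 2 * x + 2 := by
    intro x hx
    rw [Set.uIcc_of_le zero_le_one] at hx
    linarith [hx.1]
  rw [int_J, intervalIntegral.integral_eq_sub_of_hasDerivAt
    (f := fun x => Real.log (2 * x + 2) * ev Hp (2 * x - 1) - ev Q (2 * x - 1))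
    (fun x hx => ?_) ?_]
  · have h4 : Real.log 4 = 2 * Real.log 2 := by
      rw [show (4 : ℝ) = 2 ^ 2 by norm_num, Real.log_pow]; norm_num
    norm_num
    rw [h4]
    ring
  · refine ContinuousOn.intervalIntegrable ?_
    refine ContinuousOn.mul (ContinuousOn.log (by fun_prop) fun x hx => (hpos x hx).ne') ?_
    exact cont_hd.continuousOn
  · have hx0 := hpos x hx
    have d0 : HasDerivAt (fun x : ℝ => 2 * x + 2) 2 x := by
      simpa using ((hasDerivAt_id x).const_mul 2).add_const 2
    have := ((d0.log hx0.ne').mul (hasDerivAt_ev_lin Hp x)).sub (hasDerivAt_ev_lin Q x)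
    refine this.congr_deriv ?_
    rw [hd, ev_hp, ev_Hp, ← Q1]
    have hx1 : x + 1 ≠ 0 := fun h => by linarith
    have hx2 : 2 / (2 * x + 2) = 1 / (x + 1) := by
      rw [div_eq_div_iff hx0.ne' hx1]; ring
    rw [hx2]
    field_simp
    ring

theorem log_a : 287682072451780927439219005993827431503509710897761056506665 / 10 ^ 60 - 1 / 10 ^ 58 ≤ 2 * Real.log 2 - Real.log 3 ∧
    2 * Real.log 2 - Real.log 3 ≤ 287682072451780927439219005993827431503509710897761056506666 / 10 ^ 60 + 1 / 10 ^ 58 := by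
  have h := Real.abs_log_sub_add_sum_range_le (x := 1 / 4) (by rw [abs_of_pos] <;> norm_num) 105
  have e : Real.log (1 - 1 / 4) = Real.log 3 - 2 * Real.log 2 := by
    rw [show (1 - 1 / 4 : ℝ) = 3 / 2 ^ 2 by norm_num, Real.log_div (by norm_num) (by norm_num),
      Real.log_pow]
    norm_num
  rw [e, abs_of_pos (show (0 : ℝ) < 1 / 4 by norm_num)] at h
  have hs1 : 287682072451780927439219005993827431503509710897761056506665 / 10 ^ 60 ≤ ∑ i ∈ Finset.range 105, (1 / 4 : ℝ) ^ (i + 1) / (i + 1) := by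
    norm_num [Finset.sum_range_succ]
  have hs2 : ∑ i ∈ Finset.range 105, (1 / 4 : ℝ) ^ (i + 1) / (i + 1) ≤ 287682072451780927439219005993827431503509710897761056506666 / 10 ^ 60 := by
    norm_num [Finset.sum_range_succ]
  have hs3 : (1 / 4 : ℝ) ^ (105 + 1) / (1 - 1 / 4) ≤ 1 / 10 ^ 58 := by norm_num
  have := abs_le.1 (h.trans hs3)
  generalize (∑ i ∈ Finset.range 105, (1 / 4 : ℝ) ^ (i + 1) / (i + 1)) = s at *
  constructor <;> linarith

theorem log_b : 117783035656383454538794109470521705068480712564733141107348 / 10 ^ 60 - 1 / 10 ^ 58 ≤ 2 * Real.log 3 - 3 * Real.log 2 ∧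
    2 * Real.log 3 - 3 * Real.log 2 ≤ 117783035656383454538794109470521705068480712564733141107349 / 10 ^ 60 + 1 / 10 ^ 58 := by
  have h := Real.abs_log_sub_add_sum_range_le (x := 1 / 9) (by rw [abs_of_pos] <;> norm_num) 65
  have e : Real.log (1 - 1 / 9) = 3 * Real.log 2 - 2 * Real.log 3 := by
    rw [show (1 - 1 / 9 : ℝ) = 2 ^ 3 / 3 ^ 2 by norm_num,
      Real.log_div (by norm_num) (by norm_num), Real.log_pow, Real.log_pow]
    norm_num
  rw [e, abs_of_pos (show (0 : ℝ) < 1 / 9 by norm_num)] at h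
  have hs1 : 117783035656383454538794109470521705068480712564733141107348 / 10 ^ 60 ≤ ∑ i ∈ Finset.range 65, (1 / 9 : ℝ) ^ (i + 1) / (i + 1) := by
    norm_num [Finset.sum_range_succ]
  have hs2 : ∑ i ∈ Finset.range 65, (1 / 9 : ℝ) ^ (i + 1) / (i + 1) ≤ 117783035656383454538794109470521705068480712564733141107349 / 10 ^ 60 := by
    norm_num [Finset.sum_range_succ]
  have hs3 : (1 / 9 : ℝ) ^ (65 + 1) / (1 - 1 / 9) ≤ 1 / 10 ^ 58 := by norm_num
  have := abs_le.1 (h.trans hs3)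
  generalize (∑ i ∈ Finset.range 65, (1 / 9 : ℝ) ^ (i + 1) / (i + 1)) = s at *
  constructor <;> linarith

theorem final_num (I m N l2 l3 : ℝ)
    (hm : m = (6188495434440233445232091092805398125679704931443099060068066430256 : ℝ) - 4503498767743318458065402649866671208577383405034313279999090787704)
    (hN : N = (2 * (6188495434440233445232091092805398125679704931443099060068066430256 : ℝ) - 4503498767743318458065402649866671208577383405034313279999090787704) * l2 - (1669144870502422439416022945914864738870435147114678371385981766391 - (-2008459971760464927042463018896722382276361857393826533432842265725)))
    (h : |m * I - N| ≤ 10 * 3 * (2 ^ 220 / 10 ^ 52))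
    (ha : 287682072451780927439219005993827431503509710897761056506665 / 10 ^ 60 - 1 / 10 ^ 58 ≤ 2 * l2 - l3 ∧ 2 * l2 - l3 ≤ 287682072451780927439219005993827431503509710897761056506666 / 10 ^ 60 + 1 / 10 ^ 58)
    (hb : 117783035656383454538794109470521705068480712564733141107348 / 10 ^ 60 - 1 / 10 ^ 58 ≤ 2 * l3 - 3 * l2 ∧ 2 * l3 - 3 * l2 ≤ 117783035656383454538794109470521705068480712564733141107349 / 10 ^ 60 + 1 / 10 ^ 58) :
    |l3 / I - 1.0400442024560391758760644376817446547515185552379| ≤ 1e-49 := by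
  obtain ⟨a1, a2⟩ := ha
  obtain ⟨b1, b2⟩ := hb
  obtain ⟨h1, h2⟩ := abs_le.1 h
  subst hm hN
  norm_num at a1 a2 b1 b2 h1 h2
  have hI : 0 < I := by linarith
  rw [abs_le]
  constructor
  · rw [neg_le_sub_iff_le_add, ← sub_le_iff_le_add, le_div_iff₀ hI]
    norm_num
    linarith
  · rw [sub_le_iff_le_add, div_le_iff₀ hI]
    norm_num
    linarith

end BR

theorem lochs_constant (μ : Measure ℝ) [IsProbabilityMeasure μ]
    (hsupp : μ (Set.Ico (0 : ℝ) 1)ᶜ = 0)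
    (hinv : ∀ A : Set ℝ, MeasurableSet A → μ (T ⁻¹' A) = μ A)
    (hac : μ ≪ volume) :
    |Real.log 3 / (∫ x, Real.log (2 * x + 2) ∂μ) -
        1.0400442024560391758760644376817446547515185552379| ≤ 1e-49 := by
  obtain ⟨L, hL⟩ := BR.lip_hd
  have hC : ∀ x ∈ BR.J, |Real.log (2 * x + 2)| ≤ 3 := by
    intro x hx
    have hx0 : 0 ≤ x := hx.1
    have hx1 : x < 1 := hx.2
    rw [abs_of_nonneg (Real.log_nonneg (by linarith))]
    have := Real.log_le_sub_one_of_pos (show 0 < 2 * x + 2 by linarith)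
    linarith
  have hg : Measurable fun x : ℝ => Real.log (2 * x + 2) := by fun_prop
  have h := BR.acim_bound μ hsupp hinv hac hg hC hL BR.lip_resid
  have e1 : BR.ev BR.Hp 1 = ((6188495434440233445232091092805398125679704931443099060068066430256 : ℤ) : ℝ) := by
    rw [← BR.Hp_one, ← BR.ev_iev]; norm_num
  have e2 : BR.ev BR.Hp (-1) = ((4503498767743318458065402649866671208577383405034313279999090787704 : ℤ) : ℝ) := by
    rw [← BR.Hp_neg, ← BR.ev_iev]; norm_num
  have e3 : BR.ev BR.Q 1 = ((1669144870502422439416022945914864738870435147114678371385981766391 : ℤ) : ℝ) := by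
    rw [← BR.Q_one, ← BR.ev_iev]; norm_num
  have e4 : BR.ev BR.Q (-1) = (((-2008459971760464927042463018896722382276361857393826533432842265725) : ℤ) : ℝ) := by
    rw [← BR.Q_neg, ← BR.ev_iev]; norm_num
  refine BR.final_num _ _ _ (Real.log 2) (Real.log 3) ?_ ?_ h BR.log_a BR.log_b
  · rw [BR.int_hd, e1, e2]; push_cast; rfl
  · rw [BR.int_log_hd, e1, e2, e3, e4]; push_cast; rfl
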